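/- Let α ∈ (1,2], η ∈ (0,1], 0 ≤ λ < 2/η², let θ ∈ (0, 1/2) be fixed, and let f : [0,1] × [0,∞) → [0,∞) be continuous. Then the operator A maps the cone P into itself: for every x ∈ P, the function Ax belongs to P. -/

import Mathlib

open Set MeasureTheory

/-- The Green's function `G(t,s)` for the conformable fractional BVP. -/
noncomputable def Gf (α t s : ℝ) : ℝ :=
  if s ≤ t then (1 - t) * s ^ (α - 1) else t * (1 - s) * s ^ (α - 2)

/-- The auxiliary kernel `H(t,s)` for the conformable fractional BVP. -/
noncomputable def Hf (α t s : ℝ) : ℝ :=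
  if s ≤ t then (2 * t - t ^ 2 - s) * s ^ (α - 1) else t ^ 2 * (1 - s) * s ^ (α - 2)

/-- The full kernel `K(t,s) = G(t,s) + (λ t/(2 - λ η²)) H(η,s)`. -/
noncomputable def Kf (α η lam t s : ℝ) : ℝ :=
  Gf α t s + lam * t / (2 - lam * η ^ 2) * Hf α η s

/-- The cone `P = {x ∈ C([0,1],ℝ) : x ≥ 0 and min_{t ∈ [θ,1-θ]} x(t) ≥ θ²‖x‖}`. -/
def coneP (θ : ℝ) : Set C(Set.Icc (0 : ℝ) 1, ℝ) :=
  {x | (∀ t, 0 ≤ x t) ∧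
    ∀ t : Set.Icc (0 : ℝ) 1, θ ≤ (t : ℝ) → (t : ℝ) ≤ 1 - θ → θ ^ 2 * ‖x‖ ≤ x t}

theorem Gf_eq_min_mul {α t s : ℝ} (hs : 0 < s) :
    Gf α t s = min ((1 - t) * s) (t * (1 - s)) * s ^ (α - 2) := by
  have hpow : s ^ (α - 1) = s * s ^ (α - 2) := by
    rw [show α - 1 = 1 + (α - 2) by ring, Real.rpow_add hs, Real.rpow_one]
  unfold Gf
  split_ifs with h
  · rw [min_eq_left (by nlinarith), hpow]; ring
  · rw [min_eq_right (by nlinarith)]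

theorem Gf_nonneg {α t s : ℝ} (ht : t ∈ Icc (0 : ℝ) 1) (hs : s ∈ Ioc (0 : ℝ) 1) :
    0 ≤ Gf α t s := by
  rw [Gf_eq_min_mul hs.1]
  exact mul_nonneg (le_min (mul_nonneg (by linarith [ht.2]) hs.1.le)
    (mul_nonneg ht.1 (by linarith [hs.2]))) (Real.rpow_nonneg hs.1.le _)

theorem Gf_le_one {α t s : ℝ} (hα : 1 ≤ α) (ht : t ∈ Icc (0 : ℝ) 1)
    (hs : s ∈ Ioc (0 : ℝ) 1) : Gf α t s ≤ 1 := by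
  have hpow : s * s ^ (α - 2) = s ^ (α - 1) := by
    rw [show α - 1 = 1 + (α - 2) by ring, Real.rpow_add hs.1, Real.rpow_one]
  calc Gf α t s ≤ s * s ^ (α - 2) := by
        rw [Gf_eq_min_mul hs.1]
        refine mul_le_mul_of_nonneg_right ((min_le_left _ _).trans ?_)
          (Real.rpow_nonneg hs.1.le _)
        nlinarith [ht.1, hs.1]
    _ ≤ 1 := by
        rw [hpow]
        exact Real.rpow_le_one hs.1.le hs.2 (by linarith)

theorem mul_Gf_le_Gf {α θ t t' s : ℝ} (hθ : 0 ≤ θ) (ht : t ∈ Icc θ (1 - θ))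
    (ht' : t' ∈ Icc (0 : ℝ) 1) (hs : s ∈ Ioc (0 : ℝ) 1) :
    θ * Gf α t' s ≤ Gf α t s := by
  have hs0 : 0 ≤ 1 - s := by linarith [hs.2]
  have key : θ * min ((1 - t') * s) (t' * (1 - s)) ≤ min ((1 - t) * s) (t * (1 - s)) := by
    refine le_min ?_ ?_
    · calc θ * min ((1 - t') * s) (t' * (1 - s)) ≤ θ * s :=
            mul_le_mul_of_nonneg_left ((min_le_left _ _).trans
              (by nlinarith [ht'.1, hs.1])) hθ
        _ ≤ (1 - t) * s := mul_le_mul_of_nonneg_right (by linarith [ht.2]) hs.1.le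
    · calc θ * min ((1 - t') * s) (t' * (1 - s)) ≤ θ * (1 - s) :=
            mul_le_mul_of_nonneg_left ((min_le_right _ _).trans
              (by nlinarith [ht'.2, hs0])) hθ
        _ ≤ t * (1 - s) := mul_le_mul_of_nonneg_right ht.1 hs0
  rw [Gf_eq_min_mul hs.1, Gf_eq_min_mul hs.1, ← mul_assoc]
  exact mul_le_mul_of_nonneg_right key (Real.rpow_nonneg hs.1.le _)

theorem Hf_nonneg {α η s : ℝ} (hη : η ∈ Icc (0 : ℝ) 1) (hs : s ∈ Ioc (0 : ℝ) 1) :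
    0 ≤ Hf α η s := by
  unfold Hf
  split_ifs with h
  · exact mul_nonneg (by nlinarith [hη.1, hη.2]) (Real.rpow_nonneg hs.1.le _)
  · exact mul_nonneg (mul_nonneg (sq_nonneg _) (by linarith [hs.2]))
      (Real.rpow_nonneg hs.1.le _)

theorem Hf_le_one {α η s : ℝ} (hα : 1 ≤ α) (hη : η ∈ Icc (0 : ℝ) 1)
    (hs : s ∈ Ioc (0 : ℝ) 1) : Hf α η s ≤ 1 := by
  unfold Hf
  split_ifs with h
  · refine mul_le_one₀ (by nlinarith [sq_nonneg (1 - η), hs.1])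
      (Real.rpow_nonneg hs.1.le _) (Real.rpow_le_one hs.1.le hs.2 (by linarith))
  · have hpow : s ^ 2 * s ^ (α - 2) = s ^ α := by
      rw [← Real.rpow_natCast, ← Real.rpow_add hs.1]
      congr 1
      push_cast
      ring
    have hle : η ^ 2 * (1 - s) ≤ s ^ 2 := by
      have : η ^ 2 ≤ s ^ 2 := pow_le_pow_left₀ hη.1 (not_le.1 h).le 2
      nlinarith [hs.1, sq_nonneg η]
    calc η ^ 2 * (1 - s) * s ^ (α - 2) ≤ s ^ 2 * s ^ (α - 2) :=
          mul_le_mul_of_nonneg_right hle (Real.rpow_nonneg hs.1.le _)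
      _ ≤ 1 := by
          rw [hpow]
          exact Real.rpow_le_one hs.1.le hs.2 (by linarith)

theorem lam_div_nonneg {η lam : ℝ} (hη : 0 < η) (hlam0 : 0 ≤ lam) (hlam : lam < 2 / η ^ 2) :
    0 ≤ lam / (2 - lam * η ^ 2) :=
  div_nonneg hlam0 (by linarith [(lt_div_iff₀ (pow_pos hη 2)).1 hlam])

theorem Kf_eq (α η lam t s : ℝ) :
    Kf α η lam t s = Gf α t s + lam / (2 - lam * η ^ 2) * t * Hf α η s := by
  unfold Kf
  ring

theorem Kf_nonneg {α η lam t s : ℝ} (hη : η ∈ Icc (0 : ℝ) 1)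
    (hc : 0 ≤ lam / (2 - lam * η ^ 2)) (ht : t ∈ Icc (0 : ℝ) 1) (hs : s ∈ Ioc (0 : ℝ) 1) :
    0 ≤ Kf α η lam t s := by
  rw [Kf_eq]
  exact add_nonneg (Gf_nonneg ht hs) (mul_nonneg (mul_nonneg hc ht.1) (Hf_nonneg hη hs))

theorem Kf_le {α η lam t s : ℝ} (hα : 1 ≤ α) (hη : η ∈ Icc (0 : ℝ) 1)
    (hc : 0 ≤ lam / (2 - lam * η ^ 2)) (ht : t ∈ Icc (0 : ℝ) 1) (hs : s ∈ Ioc (0 : ℝ) 1) :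
    Kf α η lam t s ≤ 1 + lam / (2 - lam * η ^ 2) := by
  rw [Kf_eq]
  refine add_le_add (Gf_le_one hα ht hs) ?_
  rw [mul_assoc]
  exact mul_le_of_le_one_right hc (mul_le_one₀ ht.2 (Hf_nonneg hη hs) (Hf_le_one hα hη hs))

theorem mul_Kf_le_Kf {α η lam θ t t' s : ℝ} (hη : η ∈ Icc (0 : ℝ) 1)
    (hc : 0 ≤ lam / (2 - lam * η ^ 2)) (hθ : 0 ≤ θ) (ht : t ∈ Icc θ (1 - θ))
    (ht' : t' ∈ Icc (0 : ℝ) 1) (hs : s ∈ Ioc (0 : ℝ) 1) :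
    θ * Kf α η lam t' s ≤ Kf α η lam t s := by
  have hG := mul_Gf_le_Gf (α := α) hθ ht ht' hs
  have hH : θ * t' * (lam / (2 - lam * η ^ 2) * Hf α η s) ≤
      t * (lam / (2 - lam * η ^ 2) * Hf α η s) :=
    mul_le_mul_of_nonneg_right ((mul_le_of_le_one_right hθ ht'.2).trans ht.1)
      (mul_nonneg hc (Hf_nonneg hη hs))
  rw [Kf_eq, Kf_eq]
  linarith

theorem measurable_Kf (α η lam t : ℝ) : Measurable (Kf α η lam t) := by
  unfold Kf Gf Hf
  refine Measurable.add (Measurable.ite measurableSet_Iic ?_ ?_)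
    (Measurable.const_mul (Measurable.ite measurableSet_Iic ?_ ?_) _) <;> fun_prop

theorem continuous_Kf_left {α η lam s : ℝ} (hs : 0 < s) :
    Continuous fun t => Kf α η lam t s := by
  simp only [Kf_eq, Gf_eq_min_mul hs]
  fun_prop

/-- The kernel operator with kernel `K` sends functions continuous on `[0,1]` to continuous
functions. -/
theorem continuous_integral_Kf_mul {α η lam : ℝ} (hα : 1 ≤ α) (hη : η ∈ Icc (0 : ℝ) 1)
    (hc : 0 ≤ lam / (2 - lam * η ^ 2)) {g : ℝ → ℝ} (hg : ContinuousOn g (Icc 0 1)) :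
    (∀ t ∈ Icc (0 : ℝ) 1, IntervalIntegrable (fun s => Kf α η lam t s * g s) volume 0 1) ∧
      Continuous fun t : Icc (0 : ℝ) 1 => ∫ s in (0 : ℝ)..1, Kf α η lam t s * g s := by
  have hsub : Set.uIoc (0 : ℝ) 1 = Ioc 0 1 := uIoc_of_le zero_le_one
  have hgi : IntervalIntegrable g volume 0 1 :=
    ContinuousOn.intervalIntegrable (by rwa [uIcc_of_le zero_le_one])
  have hbi : IntervalIntegrable (fun s => (1 + lam / (2 - lam * η ^ 2)) * ‖g s‖) volume 0 1 :=
    hgi.norm.const_mul _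
  have hmeas (t : ℝ) : AEStronglyMeasurable (fun s => Kf α η lam t s * g s)
      (volume.restrict (Set.uIoc 0 1)) :=
    (measurable_Kf α η lam t).aestronglyMeasurable.mul (hgi.def'.aestronglyMeasurable)
  have hbound (t : ℝ) (ht : t ∈ Icc (0 : ℝ) 1) (s : ℝ) (hs : s ∈ Set.uIoc (0 : ℝ) 1) :
      ‖Kf α η lam t s * g s‖ ≤ (1 + lam / (2 - lam * η ^ 2)) * ‖g s‖ := by
    rw [hsub] at hs
    rw [norm_mul, Real.norm_of_nonneg (Kf_nonneg hη hc ht hs)]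
    exact mul_le_mul_of_nonneg_right (Kf_le hα hη hc ht hs) (norm_nonneg _)
  refine ⟨fun t ht => hbi.mono_fun' (hmeas t) ?_, ?_⟩
  · exact (ae_restrict_iff' measurableSet_uIoc).2 (ae_of_all _ (hbound t ht))
  · refine intervalIntegral.continuous_of_dominated_interval (fun t => hmeas t)
      (fun t => ae_of_all _ (hbound t t.2)) hbi (ae_of_all _ fun s hs => ?_)
    rw [hsub] at hs
    exact ((continuous_Kf_left hs.1).comp continuous_subtype_val).mul continuous_const

theorem stmt8 (α η lam θ : ℝ) (hα : α ∈ Set.Ioc (1 : ℝ) 2) (hη : η ∈ Set.Ioc (0 : ℝ) 1)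
    (hlam0 : 0 ≤ lam) (hlam : lam < 2 / η ^ 2) (hθ : θ ∈ Set.Ioo (0 : ℝ) (1 / 2))
    (f : ℝ → ℝ → ℝ)
    (hf : ContinuousOn (fun p : ℝ × ℝ => f p.1 p.2) (Set.Icc 0 1 ×ˢ Set.Ici 0))
    (hfnn : ∀ t ∈ Set.Icc (0 : ℝ) 1, ∀ u, 0 ≤ u → 0 ≤ f t u) :
    ∀ x ∈ coneP θ, ∃ y ∈ coneP θ, ∀ t : Set.Icc (0 : ℝ) 1,
      y t = ∫ s in (0 : ℝ)..1,
        Kf α η lam (t : ℝ) s * f s (Set.IccExtend zero_le_one (⇑x) s) := by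
  intro x hx
  have hη' : η ∈ Icc (0 : ℝ) 1 := Ioc_subset_Icc_self hη
  have hc := lam_div_nonneg hη.1 hlam0 hlam
  have hx0 (s : ℝ) : 0 ≤ IccExtend zero_le_one (⇑x) s := hx.1 _
  have hg : ContinuousOn (fun s => f s (IccExtend zero_le_one (⇑x) s)) (Icc 0 1) :=
    hf.comp (continuous_id.prodMk x.continuous.Icc_extend').continuousOn
      fun s hs => ⟨hs, hx0 s⟩
  have hg0 (s : ℝ) (hs : s ∈ Ioc (0 : ℝ) 1) : 0 ≤ f s (IccExtend zero_le_one (⇑x) s) :=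
    hfnn s (Ioc_subset_Icc_self hs) _ (hx0 s)
  obtain ⟨hint, hcont⟩ := continuous_integral_Kf_mul hα.1.le hη' hc hg
  have hnn (t : Icc (0 : ℝ) 1) : 0 ≤ ∫ s in (0 : ℝ)..1,
      Kf α η lam (t : ℝ) s * f s (IccExtend zero_le_one (⇑x) s) := by
    rw [intervalIntegral.integral_of_le zero_le_one]
    exact setIntegral_nonneg measurableSet_Ioc fun s hs =>
      mul_nonneg (Kf_nonneg hη' hc t.2 hs) (hg0 s hs)
  refine ⟨⟨_, hcont⟩, ⟨hnn, fun t ht₁ ht₂ => ?_⟩, fun t => rfl⟩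
  rw [mul_comm, ← le_div_iff₀ (pow_pos hθ.1 2)]
  refine (ContinuousMap.norm_le _ (div_nonneg (hnn t) (sq_nonneg θ))).2 fun t' => ?_
  rw [ContinuousMap.coe_mk, Real.norm_of_nonneg (hnn t'), le_div_iff₀ (pow_pos hθ.1 2)]
  have hle : θ * (∫ s in (0 : ℝ)..1,
        Kf α η lam (t' : ℝ) s * f s (IccExtend zero_le_one (⇑x) s)) ≤
      ∫ s in (0 : ℝ)..1, Kf α η lam (t : ℝ) s * f s (IccExtend zero_le_one (⇑x) s) := by
    rw [← intervalIntegral.integral_const_mul]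
    refine intervalIntegral.integral_mono_on_of_le_Ioo zero_le_one
      ((hint t' t'.2).const_mul θ) (hint t t.2) fun s hs => ?_
    have hs' := Ioo_subset_Ioc_self hs
    rw [← mul_assoc]
    exact mul_le_mul_of_nonneg_right
      (mul_Kf_le_Kf hη' hc hθ.1.le ⟨ht₁, ht₂⟩ t'.2 hs') (hg0 s hs')
  refine le_trans ?_ hle
  rw [mul_comm]
  exact mul_le_mul_of_nonneg_right (by nlinarith [hθ.1, hθ.2]) (hnn t')
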